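/- If χ : F_n → ℤ is a surjective homomorphism from a free group of rank n ≥ 2, then the kernel of χ is not finitely generated. -/

import Mathlib

/-- affine permutation `x ↦ 2^k x + c` of `ℚ` -/
def affPerm (k : ℤ) (c : ℚ) : Equiv.Perm ℚ where
  toFun x := 2 ^ k * x + c
  invFun y := 2 ^ (-k) * (y - c)
  left_inv x := by
    have : (2 : ℚ) ^ k ≠ 0 := by positivity
    simp only [zpow_neg]; field_simp; ring
  right_inv x := by
    have : (2 : ℚ) ^ k ≠ 0 := by positivity
    simp only [zpow_neg]; field_simp; ring

/-- If `χ : F_n → ℤ` is a surjective homomorphism from a free group of rank `n ≥ 2`,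
then the kernel of `χ` is not finitely generated. -/
theorem stmt2 (n : ℕ) (hn : 2 ≤ n) (χ : FreeGroup (Fin n) →* Multiplicative ℤ)
    (hχ : Function.Surjective χ) : ¬ χ.ker.FG := by
  rintro ⟨S, hS⟩
  obtain ⟨b, hb⟩ : ∃ b, χ (FreeGroup.of b) ≠ 1 := by
    by_contra! h
    have h1 : χ = 1 := by ext i; simp [h i]
    obtain ⟨g, hg⟩ := hχ (Multiplicative.ofAdd 1)
    rw [h1] at hg
    have := congrArg Multiplicative.toAdd hg
    simp at this
  have : Nontrivial (Fin n) := Fin.nontrivial_iff_two_le.mpr hn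
  obtain ⟨a, hab⟩ := exists_ne b
  let f : FreeGroup (Fin n) →* Equiv.Perm ℚ :=
    FreeGroup.lift fun i => affPerm (χ (FreeGroup.of i)).toAdd (if i = a then 1 else 0)
  have hof : ∀ i x, f (FreeGroup.of i) x
      = 2 ^ (χ (FreeGroup.of i)).toAdd * x + (if i = a then 1 else 0) := by
    intro i x
    simp only [f, FreeGroup.lift_apply_of]; rfl
  have haff : ∀ g x y, f g x - f g y = 2 ^ (χ g).toAdd * (x - y) := by
    intro g
    induction g using FreeGroup.induction_on with
    | C1 => simp
    | of i => intro x y; rw [hof, hof]; ring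
    | inv_of i h =>
      intro x y
      have := h (f (FreeGroup.of i)⁻¹ x) (f (FreeGroup.of i)⁻¹ y)
      rw [← Equiv.Perm.mul_apply, ← Equiv.Perm.mul_apply, ← map_mul] at this
      simp only [mul_inv_cancel, map_one, Equiv.Perm.one_apply] at this
      have h2 : (2 : ℚ) ^ (χ (FreeGroup.of i)).toAdd ≠ 0 := by positivity
      rw [this, map_inv χ, toAdd_inv, zpow_neg]
      field_simp
    | mul g h hg hh =>
      intro x y
      rw [map_mul, map_mul, Equiv.Perm.mul_apply, Equiv.Perm.mul_apply, hg, hh, toAdd_mul,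
        zpow_add₀ two_ne_zero]
      ring
  have hker : ∀ g ∈ χ.ker, ∀ x, f g x = x + f g 0 := by
    intro g hg x
    have := haff g x 0
    rw [MonoidHom.mem_ker.mp hg] at this
    simp at this
    linarith
  obtain ⟨D, hD0, hD⟩ : ∃ D : ℤ, D ≠ 0 ∧ ∀ g ∈ S, ∃ m : ℤ, (D : ℚ) * f g 0 = m := by
    refine ⟨∏ g ∈ S, ((f g 0).den : ℤ), ?_, ?_⟩
    · exact Finset.prod_ne_zero_iff.mpr fun g _ => by simp
    · intro g hg
      obtain ⟨e, he⟩ := Finset.dvd_prod_of_mem (fun g => ((f g 0).den : ℤ)) hg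
      refine ⟨e * (f g 0).num, ?_⟩
      rw [he]
      push_cast
      have := Rat.mul_den_eq_num (f g 0)
      rw [← this]; ring
  have hint : ∀ g ∈ χ.ker, ∃ m : ℤ, (D : ℚ) * f g 0 = m := by
    intro g hg
    rw [← hS] at hg
    induction hg using Subgroup.closure_induction with
    | mem x hx => exact hD x hx
    | one => exact ⟨0, by simp⟩
    | mul x y hx hy h1 h2 =>
      obtain ⟨m, hm⟩ := h1
      obtain ⟨k, hk⟩ := h2
      rw [hS] at hx
      refine ⟨m + k, ?_⟩
      rw [map_mul, Equiv.Perm.mul_apply, hker x hx]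
      push_cast
      rw [← hm, ← hk]; ring
    | inv x hx h1 =>
      obtain ⟨m, hm⟩ := h1
      rw [hS] at hx
      refine ⟨-m, ?_⟩
      have := hker x hx (f x⁻¹ 0)
      rw [← Equiv.Perm.mul_apply, ← map_mul] at this
      simp only [mul_inv_cancel, map_one, Equiv.Perm.one_apply] at this
      push_cast
      rw [← hm]
      linear_combination (-(D : ℚ)) * this
  have hconj : ∀ g ∈ χ.ker, ∀ t, f (t * g * t⁻¹) 0 = 2 ^ (χ t).toAdd * f g 0 := by
    intro g hg t
    have h1 := haff t (f g (f t⁻¹ 0)) (f t⁻¹ 0)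
    rw [hker g hg (f t⁻¹ 0)] at h1
    rw [map_mul, map_mul, Equiv.Perm.mul_apply, Equiv.Perm.mul_apply, hker g hg (f t⁻¹ 0)]
    have h2 : f t (f t⁻¹ 0) = 0 := by
      rw [← Equiv.Perm.mul_apply, ← map_mul]; simp
    rw [h2] at h1
    linear_combination h1
  obtain ⟨g, hg, hg0⟩ : ∃ g ∈ χ.ker, f g 0 ≠ 0 := by
    let A := FreeGroup.of a
    let B := FreeGroup.of b
    have hk : A * B * A⁻¹ * B⁻¹ ∈ χ.ker := by
      rw [MonoidHom.mem_ker]; simp [mul_comm]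
    refine ⟨_, hk, fun h0 => ?_⟩
    have h1 := hker _ hk (f (B * A) 0)
    rw [h0, ← Equiv.Perm.mul_apply, ← map_mul] at h1
    have h2 : A * B * A⁻¹ * B⁻¹ * (B * A) = A * B := by group
    rw [h2, map_mul, map_mul, Equiv.Perm.mul_apply, Equiv.Perm.mul_apply] at h1
    simp only [A, B, hof] at h1
    simp [hab.symm] at h1
    have h3 : (2 : ℚ) ^ (χ (FreeGroup.of b)).toAdd = 2 ^ (0 : ℤ) := by simp [← h1]
    have h4 := zpow_right_injective₀ (by norm_num) (by norm_num) h3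
    exact hb (by simpa using h4)
  obtain ⟨m, hm⟩ := hint g hg
  have hm0 : m ≠ 0 := by
    rintro rfl
    simp [hD0, hg0] at hm
  obtain ⟨t, ht⟩ := hχ (Multiplicative.ofAdd (-(m.natAbs : ℤ)))
  obtain ⟨k, hk⟩ := hint (t * g * t⁻¹) ((MonoidHom.normal_ker χ).conj_mem g hg t)
  rw [hconj g hg, ht, toAdd_ofAdd, zpow_neg, zpow_natCast] at hk
  have h2 : (2 : ℚ) ^ m.natAbs ≠ 0 := by positivity
  have h3 : (m : ℚ) = 2 ^ m.natAbs * k := by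
    rw [← hm, ← hk]; field_simp
  have h4 : m = 2 ^ m.natAbs * k := by exact_mod_cast h3
  have h5 : (2 ^ m.natAbs) ∣ m.natAbs := by
    have : ((2 : ℤ) ^ m.natAbs).natAbs ∣ m.natAbs := Int.natAbs_dvd_natAbs.mpr ⟨k, h4⟩
    simpa [Int.natAbs_pow] using this
  have h6 := Nat.le_of_dvd (Int.natAbs_pos.mpr hm0) h5
  exact absurd (Nat.lt_two_pow_self (n := m.natAbs)) (not_lt.mpr h6)
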